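/- Let Y ⊆ ℝ^m be a nonempty set (the reachable objective space) and let Y* ⊆ Y be its Pareto front, i.e., the set of y ∈ Y such that no z ∈ Y satisfies z_j ≤ y_j for all j with strict inequality for at least one j. Assume Y* is nonempty and every y ∈ Y* has all coordinates nonnegative (the ideal point is the zero vector). Let w ∈ ℝ^m have strictly positive entries, let y¹, ..., y^N ∈ Y be finitely many sampled objective vectors (N ≥ 1), and set g* = min_{1 ≤ i ≤ N} max_{1 ≤ j ≤ m} w_j |y^i_j|. Let A ⊆ {y¹, ..., y^N} be the set of sampled vectors not Pareto-dominated by any other sampled vector. Then the unary additive ε-indicator of A relative to Y* satisfies I¹_{ε+}(A) ≤ (max_{1 ≤ j ≤ m} 1/w_j) · g*; concretely, there exists a ∈ A such that for every y ∈ Y* and every j ∈ {1, ..., m}, a_j ≤ (max_{1 ≤ k ≤ m} 1/w_k) · g* + y_j. -/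

import Mathlib

open Finset

/-- Pareto dominance for objective vectors (to be minimized): `y₁ ≺ y₂`. -/
def Dominates {m : ℕ} (y₁ y₂ : Fin m → ℝ) : Prop :=
  (∀ j, y₁ j ≤ y₂ j) ∧ ∃ k, y₁ k < y₂ k

/-- The Pareto front of a set of objective vectors: its nondominated elements. -/
def ParetoFront {m : ℕ} (Y : Set (Fin m → ℝ)) : Set (Fin m → ℝ) :=
  {y ∈ Y | ¬ ∃ z ∈ Y, Dominates z y}

/-- In a finite family, every member is weakly dominated by a nondominated member. -/
theorem exists_le_not_dominates {ι : Type*} [Finite ι] {m : ℕ} (y : ι → Fin m → ℝ) (i : ι) :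
    ∃ k, y k ≤ y i ∧ ∀ l, ¬ Dominates (y l) (y k) := by
  obtain ⟨k, hki, hk⟩ := Set.exists_min_image {k | y k ≤ y i} (fun k => ∑ j, y k j)
    (Set.toFinite _) ⟨i, le_refl (y i)⟩
  refine ⟨k, hki, fun l ⟨hle, j, hlt⟩ => ?_⟩
  have hlk : y l ≤ y k := hle
  exact (hk l (hlk.trans hki)).not_gt
    (Finset.sum_lt_sum (fun j _ => hle j) ⟨j, mem_univ j, hlt⟩)

/-- Let `Y ⊆ ℝ^m` be nonempty with nonempty Pareto front whose elements all
have nonnegative coordinates (ideal point `0`), `w` strictly positive, `y¹, …, y^N ∈ Y` sampled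
vectors (`N ≥ 1`), `g* = min_i max_j (w j * |y i j|)`, and `A` the set of samples not dominated
by any other sample. Then `I¹_{ε+}(A) ≤ (max_j 1 / w j) * g*`; concretely, there exists `a ∈ A`
s.t. for every `y ∈ Y*` and every `j`, `a j ≤ (max_k 1 / w k) * g* + y j`. -/
theorem eps_indicator_le_weighted_tchebycheff_min
    (m N : ℕ) [NeZero m] [NeZero N]
    (Y : Set (Fin m → ℝ)) (hYne : Y.Nonempty)
    (hPFne : (ParetoFront Y).Nonempty)
    (hideal : ∀ y ∈ ParetoFront Y, ∀ j, 0 ≤ y j)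
    (w : Fin m → ℝ) (hw : ∀ j, 0 < w j)
    (y : Fin N → Fin m → ℝ) (hy : ∀ i, y i ∈ Y) :
    ∃ a ∈ {v | ∃ i, v = y i ∧ ∀ k, k ≠ i → ¬ Dominates (y k) (y i)},
      ∀ ystar ∈ ParetoFront Y, ∀ j,
        a j ≤ (univ.sup' univ_nonempty fun k => 1 / w k) *
            (univ.inf' univ_nonempty fun i =>
              univ.sup' univ_nonempty fun j' => w j' * |y i j'|) + ystar j := by
  obtain ⟨i, -, hi⟩ := exists_mem_eq_inf' (univ_nonempty (α := Fin N))
    (fun i => univ.sup' univ_nonempty fun j => w j * |y i j|)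
  obtain ⟨k, hki, hk⟩ := exists_le_not_dominates y i
  refine ⟨y k, ⟨k, rfl, fun l _ => hk l⟩, fun ystar hystar j => ?_⟩
  rw [hi]
  have hg : w j * |y i j| ≤ univ.sup' univ_nonempty fun j => w j * |y i j| :=
    le_sup' (fun j => w j * |y i j|) (mem_univ j)
  have hinv : 1 / w j ≤ univ.sup' univ_nonempty fun k => 1 / w k :=
    le_sup' (fun k => 1 / w k) (mem_univ j)
  have hwj := hw j
  have hinv_pos : 0 < 1 / w j := one_div_pos.mpr hwj
  calc y k j ≤ |y i j| := (hki j).trans (le_abs_self _)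
    _ = 1 / w j * (w j * |y i j|) := by field_simp
    _ ≤ (univ.sup' univ_nonempty fun k => 1 / w k) *
          (univ.sup' univ_nonempty fun j => w j * |y i j|) :=
        mul_le_mul hinv hg (by positivity) (hinv_pos.le.trans hinv)
    _ ≤ _ := le_add_of_nonneg_right (hideal ystar hystar j)
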